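/- For any integers r ≥ 0 and w ≥ r+2, the sum over all (k_1,...,k_r,a) with k_1+...+k_r+a = w, k_i ≥ 1, a ≥ 2, of the multiple zeta-star value ζ*(k_1,...,k_r,a) equals C(w-1, r)·ζ(w). -/

import Mathlib

/-- The multiple zeta-star value `ζ*(k₁,…,k_r) = Σ_{1 ≤ m₁ ≤ ⋯ ≤ m_r} 1/(m₁^{k₁} ⋯ m_r^{k_r})`. -/
noncomputable def mzvStar (ks : List ℕ) : ℝ :=
  ∑' f : {f : Fin ks.length → ℕ+ // Monotone f},
    ∏ i : Fin ks.length, ((f.1 i : ℝ) ^ ks.get i)⁻¹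

/-- The multiple zeta value `ζ(k₁,…,k_r)`. -/
noncomputable def mzv (ks : List ℕ) : ℝ :=
  ∑' f : {f : Fin ks.length → ℕ+ // StrictMono f},
    ∏ i : Fin ks.length, ((f.1 i : ℝ) ^ ks.get i)⁻¹
open ENNReal Finset

theorem coeff_zero_le {α β : ℕ → ℝ≥0∞} {δ : ℝ} (hδ : 0 < δ)
    (h : ∀ x : ℝ, 0 < x → x < δ →
      ∑' n, α n * ENNReal.ofReal x ^ n = ∑' n, β n * ENNReal.ofReal x ^ n)
    (hfin : ∀ x : ℝ, 0 < x → x < δ → ∑' n, β n * ENNReal.ofReal x ^ n ≠ ∞) :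
    α 0 ≤ β 0 := by
  set C := ∑' n, β (n + 1) * ENNReal.ofReal (δ / 2) ^ n with hC
  have key : ∀ x : ℝ, ∑' n, β n * ENNReal.ofReal x ^ n
      = β 0 + ENNReal.ofReal x * ∑' n, β (n + 1) * ENNReal.ofReal x ^ n := by
    intro x
    rw [tsum_eq_zero_add' ENNReal.summable, ← ENNReal.tsum_mul_left]
    simp only [pow_zero, mul_one, pow_succ]
    congr 2; ext n; ring
  have hCfin : C ≠ ∞ := by
    have := hfin (δ / 2) (by positivity) (by linarith)
    rw [key] at this
    intro hc
    rw [← hC, hc, ENNReal.mul_top (by simpa using hδ)] at this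
    simp at this
  have hb : ∀ x : ℝ, 0 < x → x < δ / 2 → α 0 ≤ β 0 + ENNReal.ofReal x * C := by
    intro x hx hx'
    calc α 0 = α 0 * ENNReal.ofReal x ^ 0 := by simp
      _ ≤ ∑' n, α n * ENNReal.ofReal x ^ n := ENNReal.le_tsum 0
      _ = _ := h x hx (by linarith)
      _ = _ := key x
      _ ≤ _ := by gcongr; exact ENNReal.tsum_le_tsum fun n => by gcongr
  have hlim : Filter.Tendsto (fun x : ℝ => β 0 + ENNReal.ofReal x * C)
      (nhdsWithin 0 (Set.Ioi 0)) (nhds (β 0 + ENNReal.ofReal 0 * C)) := by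
    refine Filter.Tendsto.mono_left ?_ nhdsWithin_le_nhds
    refine Filter.Tendsto.add tendsto_const_nhds ?_
    exact ENNReal.Tendsto.mul_const (ENNReal.tendsto_ofReal Filter.tendsto_id) (Or.inr hCfin)
  rw [ENNReal.ofReal_zero, zero_mul, add_zero] at hlim
  refine ge_of_tendsto hlim ?_
  filter_upwards [Ioo_mem_nhdsGT (show (0:ℝ) < δ / 2 by positivity)] with x hx
  exact hb x hx.1 hx.2

theorem coeff_eq_of_tsum_eq {δ : ℝ} (hδ : 0 < δ) (n : ℕ) : ∀ {α β : ℕ → ℝ≥0∞},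
    (∀ x : ℝ, 0 < x → x < δ →
      ∑' n, α n * ENNReal.ofReal x ^ n = ∑' n, β n * ENNReal.ofReal x ^ n) →
    (∀ x : ℝ, 0 < x → x < δ → ∑' n, β n * ENNReal.ofReal x ^ n ≠ ∞) → α n = β n := by
  have h0 : ∀ {α β : ℕ → ℝ≥0∞}, (∀ x : ℝ, 0 < x → x < δ →
      ∑' n, α n * ENNReal.ofReal x ^ n = ∑' n, β n * ENNReal.ofReal x ^ n) →
    (∀ x : ℝ, 0 < x → x < δ → ∑' n, β n * ENNReal.ofReal x ^ n ≠ ∞) → α 0 = β 0 :=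
    fun h hfin => le_antisymm (coeff_zero_le hδ h hfin)
      (coeff_zero_le hδ (fun x hx hx' => (h x hx hx').symm)
        (fun x hx hx' => by rw [h x hx hx']; exact hfin x hx hx'))
  have key : ∀ (γ : ℕ → ℝ≥0∞) (x : ℝ), ∑' n, γ n * ENNReal.ofReal x ^ n
      = γ 0 + ENNReal.ofReal x * ∑' n, γ (n + 1) * ENNReal.ofReal x ^ n := by
    intro γ x
    rw [tsum_eq_zero_add' ENNReal.summable, ← ENNReal.tsum_mul_left]
    simp only [pow_zero, mul_one, pow_succ]
    congr 2; ext n; ring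
  induction n with
  | zero => exact h0
  | succ n ih =>
    intro α β h hfin
    refine ih (α := fun n => α (n + 1)) (β := fun n => β (n + 1)) (fun x hx hx' => ?_)
      (fun x hx hx' hc => ?_)
    · have h1 := h x hx hx'
      have h2 := hfin x hx hx'
      rw [key β] at h2
      rw [key α, key β, h0 h hfin, ENNReal.add_right_inj (fun hc => h2 (by simp [hc]))] at h1
      exact (ENNReal.mul_right_inj (by simpa using hx) ENNReal.ofReal_ne_top).1 h1
    · have h2 := hfin x hx hx'
      rw [key β, hc, ENNReal.mul_top (by simpa using hx)] at h2
      simp at h2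

/-- The summand `x (1-x)⋯(N-x) / ((j+1-v)⋯(j+N+1-v))`. -/
noncomputable def connector (x v : ℝ) (N j : ℕ) : ℝ :=
  x * (∏ l ∈ range N, ((l : ℝ) + 1 - x)) / ∏ l ∈ range (N + 1), ((l : ℝ) + j + 1 - v)

section connector
variable {x v : ℝ}

theorem connector_nonneg (hx : 0 < x) (hx1 : x ≤ 1) (hv : v ≤ 1 / 2) (N j : ℕ) :
    0 ≤ connector x v N j := by
  unfold connector
  have h1 : ∀ l : ℕ, 0 ≤ (l : ℝ) + 1 - x := fun l => by
    have : (0:ℝ) ≤ l := l.cast_nonneg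
    linarith
  have h2 : ∀ l : ℕ, 0 ≤ (l : ℝ) + j + 1 - v := fun l => by
    have : (0:ℝ) ≤ l := l.cast_nonneg
    have : (0:ℝ) ≤ j := j.cast_nonneg
    linarith
  exact div_nonneg (mul_nonneg hx.le (prod_nonneg fun l _ => h1 l)) (prod_nonneg fun l _ => h2 l)

theorem connector_succ_left (N j : ℕ) :
    connector x v (N + 1) j = connector x v N j * ((N + 1 - x) / (N + 1 + j + 1 - v)) := by
  unfold connector
  rw [prod_range_succ _ N, prod_range_succ _ (N + 1)]
  push_cast
  rw [div_mul_div_comm, mul_assoc]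

theorem connector_succ_right (hv : v ≤ 1 / 2) (N j : ℕ) :
    connector x v N (j + 1) = connector x v N j * ((j + 1 - v) / (N + j + 2 - v)) := by
  unfold connector
  have h2 : ∀ l : ℕ, 0 < (l : ℝ) + j + 1 - v := fun l => by
    have : (0:ℝ) ≤ l := l.cast_nonneg
    have : (0:ℝ) ≤ j := j.cast_nonneg
    linarith
  have hp : 0 < ∏ l ∈ range N, ((l : ℝ) + (j + 1 : ℕ) + 1 - v) :=
    prod_pos fun l _ => by have := h2 (l + 1); push_cast at *; linarith
  have e : ∏ l ∈ range (N + 1), ((l : ℝ) + j + 1 - v)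
      = (∏ l ∈ range N, ((l : ℝ) + (j + 1 : ℕ) + 1 - v)) * (j + 1 - v) := by
    rw [prod_range_succ']
    congr 1
    · exact prod_congr rfl fun l _ => by push_cast; ring
    · push_cast; ring
  have h0 : 0 < (j : ℝ) + 1 - v := by simpa using h2 0
  have hN : 0 < (N : ℝ) + j + 2 - v := by have := h2 (N + 1); push_cast at *; linarith
  rw [e, prod_range_succ]
  have e2 : (N : ℝ) + (j + 1 : ℕ) + 1 - v = N + j + 2 - v := by push_cast; ring
  rw [e2]
  field_simp

theorem hasSum_connector_right (hx : 0 < x) (hx1 : x ≤ 1) (hv : v ≤ 1 / 2) (N : ℕ) :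
    HasSum (fun j : ℕ => connector x v N j / (N + j + 2 - v)) (connector x v N 0 / (N + 1)) := by
  have hpos : ∀ j : ℕ, 0 < (N : ℝ) + j + 2 - v := fun j => by
    have : (0:ℝ) ≤ N := N.cast_nonneg
    have : (0:ℝ) ≤ j := j.cast_nonneg
    linarith
  have hbd : ∀ j : ℕ, connector x v N j ≤ connector x v N 0 * ((1 - v) / (j + 1 - v)) := by
    intro j
    induction j with
    | zero =>
      have : 1 - v ≠ 0 := by linarith
      simp [this]
    | succ j ih =>
      have hj : (0:ℝ) ≤ j := j.cast_nonneg
      have hN : (0:ℝ) ≤ N := N.cast_nonneg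
      rw [connector_succ_right hv]
      have h1 : 0 < (j : ℝ) + 1 - v := by linarith
      have h2 : 0 < (j : ℝ) + 1 + 1 - v := by linarith
      calc _ ≤ connector x v N 0 * ((1 - v) / (j + 1 - v)) * ((j + 1 - v) / (N + j + 2 - v)) := by
            have := hpos j
            gcongr
        _ = connector x v N 0 * ((1 - v) / (N + j + 2 - v)) := by
            have := hpos j
            field_simp
        _ ≤ _ := by
            push_cast
            have := connector_nonneg hx hx1 hv N 0
            have : 0 ≤ 1 - v := by linarith
            exact mul_le_mul_of_nonneg_left
              (div_le_div_of_nonneg_left this h2 (by linarith)) ‹_›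
  have hlim : Filter.Tendsto (fun j => connector x v N j) Filter.atTop (nhds 0) := by
    refine squeeze_zero (fun j => connector_nonneg hx hx1 hv N j) hbd ?_
    rw [show (0:ℝ) = connector x v N 0 * 0 by simp]
    refine Filter.Tendsto.const_mul _ (Filter.Tendsto.const_div_atTop ?_ _)
    have := Filter.tendsto_atTop_add_const_right Filter.atTop (1 - v)
      (tendsto_natCast_atTop_atTop (R := ℝ))
    exact this.congr fun j => by ring
  rw [hasSum_iff_tendsto_nat_of_nonneg
    (fun j => div_nonneg (connector_nonneg hx hx1 hv N j) (hpos j).le)]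
  have hs : ∀ J, ∑ j ∈ range J, connector x v N j / (N + j + 2 - v)
      = (connector x v N 0 - connector x v N J) / (N + 1) := by
    intro J
    induction J with
    | zero => simp
    | succ J ih =>
      rw [sum_range_succ, ih, connector_succ_right hv]
      have := hpos J
      field_simp
      ring
  simp only [hs]
  simpa using (hlim.const_sub (connector x v N 0)).div_const ((N : ℝ) + 1)

theorem hasSum_connector_left (hx : 0 < x) (hxv : x ≤ v) (hv : v ≤ 1 / 2) (j : ℕ) :
    HasSum (fun N : ℕ => connector x v N j / (N + j + 2 - v))
      (1 / (j + 1 - v) - 1 / (j + 1 - v + x)) := by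
  have hx1 : x ≤ 1 := by linarith
  have hj : (0:ℝ) ≤ j := j.cast_nonneg
  have hpos : ∀ N : ℕ, 0 < (N : ℝ) + j + 2 - v := fun N => by
    have : (0:ℝ) ≤ N := N.cast_nonneg
    linarith
  have hbd : ∀ N : ℕ, connector x v N j ^ 2 ≤ connector x v 0 j ^ 2 * (1 / (N + 1)) := by
    intro N
    induction N with
    | zero => simp
    | succ N ih =>
      have hN : (0:ℝ) ≤ N := N.cast_nonneg
      rw [connector_succ_left, mul_pow]
      have h1 : 0 ≤ (N : ℝ) + 1 - x := by linarith
      calc _ ≤ connector x v 0 j ^ 2 * (1 / (N + 1)) * ((N + 1 - x) / (N + 1 + j + 1 - v)) ^ 2 := by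
            gcongr
        _ ≤ connector x v 0 j ^ 2 * (1 / (N + 1)) * ((N + 1) / (N + 1 + 1 / 2)) ^ 2 := by
            have : (0:ℝ) ≤ N + 1 + j + 1 - v := by linarith
            gcongr <;> linarith
        _ ≤ connector x v 0 j ^ 2 * (1 / (N + 1)) * ((N + 1) / (N + 2)) := by
            gcongr
            rw [div_pow, div_le_div_iff₀ (by positivity) (by positivity)]
            nlinarith [mul_nonneg hN hN]
        _ = _ := by push_cast; field_simp; ring
  have hlim2 : Filter.Tendsto (fun N => connector x v N j ^ 2) Filter.atTop (nhds 0) := by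
    refine squeeze_zero (fun N => sq_nonneg _) hbd ?_
    rw [show (0:ℝ) = connector x v 0 j ^ 2 * 0 by simp]
    exact Filter.Tendsto.const_mul _ tendsto_one_div_add_atTop_nhds_zero_nat
  have hlim : Filter.Tendsto (fun N => connector x v N j) Filter.atTop (nhds 0) := by
    have := hlim2.sqrt
    simpa [Real.sqrt_sq (connector_nonneg hx hx1 hv _ j)] using this
  rw [hasSum_iff_tendsto_nat_of_nonneg
    (fun N => div_nonneg (connector_nonneg hx hx1 hv N j) (hpos N).le)]
  have hc : 0 < (j : ℝ) + 1 - v + x := by linarith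
  have hc' : 0 < (j : ℝ) + 1 - v := by linarith
  have hs : ∀ M, ∑ N ∈ range M, connector x v N j / (N + j + 2 - v)
      = (connector x v 0 j - connector x v M j) / (j + 1 - v + x) := by
    intro M
    induction M with
    | zero => simp
    | succ M ih =>
      rw [sum_range_succ, ih, connector_succ_left,
        show (M : ℝ) + 1 + j + 1 - v = M + j + 2 - v by ring]
      have := hpos M
      field_simp
      ring
  simp only [hs]
  convert (hlim.const_sub (connector x v 0 j)).div_const ((j : ℝ) + 1 - v + x) using 2
  simp only [connector, range_zero, prod_empty, zero_add, prod_range_one, Nat.cast_zero]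
  field_simp
  ring

theorem tsum_connector_div (hx : 0 < x) (hxv : x ≤ v) (hv : v ≤ 1 / 2) :
    ∑' N : ℕ, ENNReal.ofReal (connector x v N 0 / (N + 1))
      = ∑' j : ℕ, ENNReal.ofReal (1 / (j + 1 - v) - 1 / (j + 1 - v + x)) := by
  have hx1 : x ≤ 1 := by linarith
  have hnn : ∀ N j : ℕ, 0 ≤ connector x v N j / (N + j + 2 - v) := fun N j => by
    have : (0:ℝ) ≤ N := N.cast_nonneg
    have : (0:ℝ) ≤ j := j.cast_nonneg
    exact div_nonneg (connector_nonneg hx hx1 hv N j) (by linarith)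
  have h1 : ∀ N : ℕ, ENNReal.ofReal (connector x v N 0 / (N + 1))
      = ∑' j : ℕ, ENNReal.ofReal (connector x v N j / (N + j + 2 - v)) := fun N => by
    have := hasSum_connector_right hx hx1 hv N
    rw [← this.tsum_eq, ENNReal.ofReal_tsum_of_nonneg (hnn N) this.summable]
  have h2 : ∀ j : ℕ, ENNReal.ofReal (1 / (j + 1 - v) - 1 / (j + 1 - v + x))
      = ∑' N : ℕ, ENNReal.ofReal (connector x v N j / (N + j + 2 - v)) := fun j => by
    have := hasSum_connector_left hx hxv hv j
    rw [← this.tsum_eq, ENNReal.ofReal_tsum_of_nonneg (fun N => hnn N j) this.summable]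
  simp only [h1, h2]
  exact ENNReal.tsum_comm

theorem tsum_ofReal_sub_ne_top (hx : 0 < x) (hv : v ≤ 1 / 2) :
    ∑' j : ℕ, ENNReal.ofReal (1 / (j + 1 - v) - 1 / (j + 1 - v + x)) ≠ ∞ := by
  have hs : Summable fun j : ℕ => 4 * x * (1 / ((j : ℝ) + 1) ^ 2) := by
    have := (summable_nat_add_iff 1).2 (Real.summable_one_div_nat_pow.2 one_lt_two)
    push_cast at this
    exact this.mul_left _
  refine ne_top_of_le_ne_top (hs.tsum_ofReal_ne_top) (ENNReal.tsum_le_tsum fun j => ?_)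
  apply ENNReal.ofReal_le_ofReal
  have hj : (0:ℝ) ≤ j := j.cast_nonneg
  have h1 : ((j : ℝ) + 1) / 2 ≤ j + 1 - v := by linarith
  have h0 : 0 < ((j : ℝ) + 1) / 2 := by linarith
  have h2 : ((j : ℝ) + 1) / 2 ≤ j + 1 - v + x := by linarith
  calc _ = x / ((j + 1 - v) * (j + 1 - v + x)) := by
        have : 0 < (j : ℝ) + 1 - v := by linarith
        have : 0 < (j : ℝ) + 1 - v + x := by linarith
        field_simp; ring
    _ ≤ x / (((j : ℝ) + 1) / 2 * (((j : ℝ) + 1) / 2)) := by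
        have := h0.le.trans h1
        gcongr
    _ = _ := by field_simp; norm_num

end connector

/-- `mzvStar` with values in `ℝ≥0∞`, as an iterated sum over `n < m₁ ≤ m₂ ≤ ⋯`. -/
noncomputable def starTail : ℕ → List ℕ → ℝ≥0∞
  | _, [] => 1
  | n, k :: ks => ∑' m : ℕ, if n ≤ m then ((m + 1 : ℝ≥0∞) ^ k)⁻¹ * starTail m ks else 0

/-- Monotone sequences bounded below by `n`, split off the first entry. -/
def monotoneConsEquiv (l : ℕ) (n : ℕ+) :
    {f : Fin (l + 1) → ℕ+ // Monotone f ∧ ∀ i, n ≤ f i} ≃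
      Σ m : {m : ℕ+ // n ≤ m}, {g : Fin l → ℕ+ // Monotone g ∧ ∀ i, m.1 ≤ g i} where
  toFun f := ⟨⟨f.1 0, f.2.2 0⟩, ⟨fun i => f.1 i.succ,
    fun _ _ h => f.2.1 (Fin.succ_le_succ_iff.2 h), fun i => f.2.1 (Fin.zero_le _)⟩⟩
  invFun p := ⟨Fin.cons p.1.1 p.2.1, by
    refine ⟨fun i j h => ?_, fun i => ?_⟩
    · induction i using Fin.cases with
      | zero =>
        induction j using Fin.cases with
        | zero => exact le_rfl
        | succ j => simpa using p.2.2.2 j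
      | succ i =>
        induction j using Fin.cases with
        | zero => simp at h
        | succ j => simpa using p.2.2.1 (Fin.succ_le_succ_iff.1 h)
    · induction i using Fin.cases with
      | zero => simpa using p.1.2
      | succ i => simpa using p.1.2.trans (p.2.2.2 i)⟩
  left_inv f := by
    ext i
    induction i using Fin.cases <;> simp
  right_inv p := by
    obtain ⟨⟨m, hm⟩, ⟨g, hg⟩⟩ := p
    rfl

theorem tsum_monotone_eq_starTail (ks : List ℕ) : ∀ n : ℕ,
    ∑' f : {f : Fin ks.length → ℕ+ // Monotone f ∧ ∀ i, n.succPNat ≤ f i},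
      ∏ i : Fin ks.length, (((f.1 i : ℕ) : ℝ≥0∞) ^ ks.get i)⁻¹ = starTail n ks := by
  induction ks with
  | nil =>
    intro n
    have : Unique {f : Fin ([] : List ℕ).length → ℕ+ // Monotone f ∧ ∀ i, n.succPNat ≤ f i} :=
      { default := ⟨fun i => i.elim0, fun i => i.elim0, fun i => i.elim0⟩
        uniq := fun f => Subtype.ext (funext fun i => i.elim0) }
    rw [tsum_eq_single default (fun b hb => (hb (Subsingleton.elim _ _)).elim)]
    simp [starTail]
  | cons k ks ih =>
    intro n
    rw [starTail]
    refine ((monotoneConsEquiv ks.length n.succPNat).symm.tsum_eq _).symm.trans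
      ((ENNReal.tsum_sigma' _).trans ?_)
    have h1 : ∀ m : {m : ℕ+ // n.succPNat ≤ m},
        ∑' g : {g : Fin ks.length → ℕ+ // Monotone g ∧ ∀ i, m.1 ≤ g i},
          ∏ i : Fin (ks.length + 1),
            ((((((monotoneConsEquiv ks.length n.succPNat).symm ⟨m, g⟩).1 i : ℕ+) : ℕ) : ℝ≥0∞) ^
              (k :: ks).get i)⁻¹ =
          (((m.1 : ℕ) : ℝ≥0∞) ^ k)⁻¹ * starTail (m.1.natPred) ks := by
      intro m
      have ih' := ih m.1.natPred
      rw [PNat.succPNat_natPred] at ih'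
      rw [← ih', ← ENNReal.tsum_mul_left]
      refine tsum_congr fun g => ?_
      rw [Fin.prod_univ_succ]
      rfl
    refine (tsum_congr h1).trans ((tsum_subtype {m : ℕ+ | n.succPNat ≤ m}
      (fun m : ℕ+ => (((m : ℕ) : ℝ≥0∞) ^ k)⁻¹ * starTail m.natPred ks)).trans ?_)
    rw [← Equiv.pnatEquivNat.symm.tsum_eq]
    refine tsum_congr fun m => ?_
    simp [Set.indicator_apply]

theorem mzvStar_eq_toReal (ks : List ℕ) : mzvStar ks = (starTail 0 ks).toReal := by
  rw [← tsum_monotone_eq_starTail, ENNReal.tsum_toReal_eq]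
  · rw [mzvStar]
    let e : {f : Fin ks.length → ℕ+ // Monotone f} ≃
        {f : Fin ks.length → ℕ+ // Monotone f ∧ ∀ i, (0 : ℕ).succPNat ≤ f i} :=
      Equiv.subtypeEquivRight fun f => (and_iff_left fun i => (f i).2).symm
    rw [← e.tsum_eq]
    refine tsum_congr fun f => ?_
    simp [e, ENNReal.toReal_prod, ENNReal.toReal_inv]
    rfl
  · intro f
    refine ENNReal.prod_ne_top fun i _ => ?_
    simp

theorem mzv_singleton (w : ℕ) :
    mzv [w] = (∑' m : ℕ, ((m + 1 : ℝ≥0∞) ^ w)⁻¹).toReal := by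
  rw [ENNReal.tsum_toReal_eq (fun m => by simp), mzv]
  let e : ℕ ≃ {f : Fin [w].length → ℕ+ // StrictMono f} :=
    { toFun := fun m => ⟨fun _ => m.succPNat, fun i j h => by
        have hi := i.2; have hj := j.2; have : (i : ℕ) < j := h
        simp only [List.length_singleton] at hi hj; omega⟩
      invFun := fun f => (f.1 ⟨0, by simp⟩).natPred
      left_inv := fun m => by simp
      right_inv := fun f => by
        ext i
        have hi := i.2
        simp only [List.length_singleton] at hi
        have : i = ⟨0, by simp⟩ := Fin.ext (by simp)
        subst this
        simp }
  rw [← e.tsum_eq]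
  refine tsum_congr fun m => ?_
  simp [e, ENNReal.toReal_inv, ENNReal.toReal_add]

/-- Weighted sums over chains `n ≤ l₁ ≤ ⋯ ≤ l_r ≤ m`. -/
noncomputable def chainSum (z : ℕ → ℝ≥0∞) : ℕ → ℕ → ℕ → ℝ≥0∞
  | 0, n, m => if n ≤ m then 1 else 0
  | r + 1, n, m => ∑' l : ℕ, if n ≤ l then z l * chainSum z r l m else 0

theorem chainSum_of_lt (z : ℕ → ℝ≥0∞) (r : ℕ) : ∀ {n m : ℕ}, m < n → chainSum z r n m = 0 := by
  induction r with
  | zero => intro n m h; simp [chainSum, h]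
  | succ r ih =>
    intro n m h
    simp only [chainSum, ENNReal.tsum_eq_zero]
    intro l
    split_ifs with hl
    · rw [ih (h.trans_le hl), mul_zero]
    · rfl

theorem chainSum_succ (z : ℕ → ℝ≥0∞) (r n m : ℕ) :
    chainSum z (r + 1) n m = z n * chainSum z r n m + chainSum z (r + 1) (n + 1) m := by
  simp only [chainSum]
  refine (ENNReal.summable.tsum_eq_add_tsum_ite' n).trans ?_
  congr 1
  · simp
  · refine tsum_congr fun l => ?_
    split_ifs <;> first | rfl | omega

/-- The generating function of `chainSum` in the length of the chain. -/
noncomputable def chainGen (z : ℕ → ℝ≥0∞) (y : ℝ≥0∞) (n m : ℕ) : ℝ≥0∞ :=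
  ∑' r : ℕ, y ^ r * chainSum z r n m

theorem chainGen_eq (z : ℕ → ℝ≥0∞) (y : ℝ≥0∞) (n m : ℕ) (hnm : n ≤ m) :
    chainGen z y n m = (1 - y * z n)⁻¹ * (if n < m then chainGen z y (n + 1) m else 1) := by
  set q := y * z n with hq
  set T := if n < m then chainGen z y (n + 1) m else 1 with hT
  have hT' : T = 1 + ∑' r : ℕ, y ^ (r + 1) * chainSum z (r + 1) (n + 1) m := by
    rw [hT]
    split_ifs with h
    · rw [chainGen, tsum_eq_zero_add' ENNReal.summable]
      simp [chainSum, Nat.succ_le_of_lt h]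
    · simp [chainSum_of_lt z _ (show m < n + 1 by omega)]
  have hinv : (1 - q)⁻¹ = 1 + q * (1 - q)⁻¹ := by
    rw [← ENNReal.tsum_geometric, ← ENNReal.tsum_mul_left]
    conv_lhs => rw [tsum_eq_zero_add' ENNReal.summable]
    simp [pow_succ, mul_comm]
  have hstep : ∀ r, y ^ (r + 1) * chainSum z (r + 1) n m = q * (y ^ r * chainSum z r n m) +
      y ^ (r + 1) * chainSum z (r + 1) (n + 1) m := by
    intro r
    rw [chainSum_succ, hq]
    ring
  have hrec : chainGen z y n m = T + q * chainGen z y n m := by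
    conv_lhs => rw [chainGen, tsum_eq_zero_add' ENNReal.summable]
    simp only [hstep]
    rw [ENNReal.tsum_add, hT', ENNReal.tsum_mul_left, chainGen]
    simp only [chainSum, hnm, if_true, pow_zero, mul_one]
    ring
  have hpart : ∀ R, ∑ r ∈ range R, y ^ r * chainSum z r n m ≤ (1 - q)⁻¹ * T := by
    intro R
    induction R with
    | zero => simp
    | succ R ih =>
      rw [sum_range_succ']
      simp only [hstep]
      rw [sum_add_distrib, ← mul_sum]
      calc _ ≤ q * ((1 - q)⁻¹ * T) + ∑' r : ℕ, y ^ (r + 1) * chainSum z (r + 1) (n + 1) m + 1 := by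
            gcongr
            · exact ENNReal.sum_le_tsum _
            · simp [chainSum, hnm]
        _ = T + q * (1 - q)⁻¹ * T := by rw [hT']; ring
        _ = (1 + q * (1 - q)⁻¹) * T := by ring
        _ = _ := by rw [← hinv]
  have hle : chainGen z y n m ≤ (1 - q)⁻¹ * T := by
    rw [chainGen, ENNReal.tsum_eq_iSup_nat]
    exact iSup_le hpart
  refine le_antisymm hle ?_
  have hge : ∀ R, (∑ r ∈ range R, q ^ r) * T ≤ chainGen z y n m := by
    intro R
    induction R with
    | zero => simp
    | succ R ih =>
      rw [sum_range_succ', hrec]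
      calc _ = T + q * ((∑ r ∈ range R, q ^ r) * T) := by
            rw [← mul_assoc, mul_sum]; simp only [pow_succ']; ring
        _ ≤ _ := by gcongr
  rw [← ENNReal.tsum_geometric, ENNReal.tsum_eq_iSup_nat, ENNReal.iSup_mul]
  exact iSup_le hge

theorem chainGen_eq_prod (z : ℕ → ℝ≥0∞) (y : ℝ≥0∞) (d n : ℕ) :
    chainGen z y n (n + d) = ∏ l ∈ range (d + 1), (1 - y * z (n + l))⁻¹ := by
  induction d generalizing n with
  | zero => rw [chainGen_eq z y n _ (by omega)]; simp
  | succ d ih =>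
    rw [chainGen_eq z y n _ (by omega), if_pos (by omega),
      show n + (d + 1) = n + 1 + d by ring, ih, prod_range_succ' _ (d + 1), mul_comm]
    congr 1
    exact prod_congr rfl fun l _ => by rw [add_assoc n 1 l, add_comm 1 l]

/-- The weight generating function of `starTail n (k₁,…,k_r,a)` over `kᵢ ≥ 1`, `a ≥ 2`. -/
noncomputable def starGen (x : ℝ≥0∞) (r n : ℕ) : ℝ≥0∞ :=
  ∑' k : Fin r → ℕ, ∑' a : ℕ,
    x ^ (∑ i, (k i + 1) + (a + 2)) * starTail n (List.ofFn (fun i => k i + 1) ++ [a + 2])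

/-- `∑_{a ≥ s} (x / (m + 1)) ^ a`. -/
noncomputable def geomTail (x : ℝ≥0∞) (s m : ℕ) : ℝ≥0∞ :=
  ∑' a : ℕ, (x * (m + 1 : ℝ≥0∞)⁻¹) ^ (a + s)

theorem starGen_succ (x : ℝ≥0∞) (r n : ℕ) :
    starGen x (r + 1) n = ∑' m : ℕ, if n ≤ m then geomTail x 1 m * starGen x r m else 0 := by
  have h : ∀ (k₀ : ℕ) (k : Fin r → ℕ) (a : ℕ),
      x ^ (∑ i, ((Fin.cons k₀ k : Fin (r + 1) → ℕ) i + 1) + (a + 2)) *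
        starTail n (List.ofFn (fun i => (Fin.cons k₀ k : Fin (r + 1) → ℕ) i + 1) ++ [a + 2]) =
      ∑' m : ℕ, if n ≤ m then (x * (m + 1 : ℝ≥0∞)⁻¹) ^ (k₀ + 1) *
        (x ^ (∑ i, (k i + 1) + (a + 2)) *
          starTail m (List.ofFn (fun i => k i + 1) ++ [a + 2])) else 0 := by
    intro k₀ k a
    simp only [Fin.sum_univ_succ, List.ofFn_succ, Fin.cons_zero, Fin.cons_succ, List.cons_append,
      starTail, ← ENNReal.tsum_mul_left]
    refine tsum_congr fun m => ?_
    split_ifs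
    · rw [mul_pow, ENNReal.inv_pow]; ring
    · simp
  rw [starGen, ← (Fin.consEquiv (fun _ : Fin (r + 1) => ℕ)).tsum_eq, ENNReal.tsum_prod']
  simp only [Fin.consEquiv_apply, h]
  have h2 : ∀ k₀ : ℕ, (∑' (k : Fin r → ℕ) (a : ℕ) (m : ℕ),
      if n ≤ m then (x * (m + 1 : ℝ≥0∞)⁻¹) ^ (k₀ + 1) *
        (x ^ (∑ i, (k i + 1) + (a + 2)) *
          starTail m (List.ofFn (fun i => k i + 1) ++ [a + 2])) else 0) =
      ∑' m : ℕ, if n ≤ m then (x * (m + 1 : ℝ≥0∞)⁻¹) ^ (k₀ + 1) * starGen x r m else 0 := by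
    intro k₀
    have h3 : ∀ k : Fin r → ℕ, (∑' (a : ℕ) (m : ℕ),
      if n ≤ m then (x * (m + 1 : ℝ≥0∞)⁻¹) ^ (k₀ + 1) *
        (x ^ (∑ i, (k i + 1) + (a + 2)) *
          starTail m (List.ofFn (fun i => k i + 1) ++ [a + 2])) else 0) = _ :=
      fun k => ENNReal.tsum_comm
    simp only [h3]
    rw [ENNReal.tsum_comm]
    refine tsum_congr fun m => ?_
    split_ifs
    · simp only [ENNReal.tsum_mul_left, starGen]
    · simp
  refine (tsum_congr h2).trans ?_
  rw [ENNReal.tsum_comm]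
  refine tsum_congr fun m => ?_
  split_ifs
  · rw [ENNReal.tsum_mul_right, geomTail]
  · simp

theorem starGen_eq (x : ℝ≥0∞) (r : ℕ) : ∀ n : ℕ,
    starGen x r n = ∑' m : ℕ, geomTail x 2 m * chainSum (geomTail x 1) r n m := by
  induction r with
  | zero =>
    intro n
    rw [starGen, tsum_eq_single default (fun b hb => (hb (Subsingleton.elim _ _)).elim)]
    simp only [univ_eq_empty, sum_empty, zero_add, List.ofFn_zero, List.nil_append, starTail,
      mul_one, chainSum, ← ENNReal.tsum_mul_left]
    rw [ENNReal.tsum_comm]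
    refine tsum_congr fun m => ?_
    split_ifs
    · rw [mul_one, geomTail]
      exact tsum_congr fun a => by rw [mul_pow, ENNReal.inv_pow]
    · simp
  | succ r ih =>
    intro n
    simp only [starGen_succ, ih, chainSum, ← ENNReal.tsum_mul_left]
    have : ∀ l : ℕ, (if n ≤ l then ∑' m : ℕ, geomTail x 1 l *
        (geomTail x 2 m * chainSum (geomTail x 1) r l m) else 0) =
        ∑' m : ℕ, geomTail x 2 m *
          (if n ≤ l then geomTail x 1 l * chainSum (geomTail x 1) r l m else 0) := by
      intro l
      split_ifs
      · exact tsum_congr fun m => by ring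
      · simp
    simp only [this]
    rw [ENNReal.tsum_comm]

/-- The sum of the star values of depth `r + 1` and weight `w`. -/
noncomputable def starCoeff (r w : ℕ) : ℝ≥0∞ :=
  ∑' q : {q : (Fin r → ℕ) × ℕ // ∑ i, (q.1 i + 1) + (q.2 + 2) = w},
    starTail 0 (List.ofFn (fun i => q.1.1 i + 1) ++ [q.1.2 + 2])

theorem tsum_starCoeff (x : ℝ≥0∞) (r : ℕ) :
    ∑' w : ℕ, starCoeff r w * x ^ w = starGen x r 0 := by
  rw [starGen, ← ENNReal.tsum_prod, ← (Equiv.sigmaFiberEquiv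
    (fun q : (Fin r → ℕ) × ℕ => ∑ i, (q.1 i + 1) + (q.2 + 2))).tsum_eq]
  refine Eq.trans ?_ (ENNReal.tsum_sigma' _).symm
  refine tsum_congr fun w => ?_
  rw [starCoeff, ← ENNReal.tsum_mul_right]
  refine tsum_congr fun q => ?_
  simp only [Equiv.sigmaFiberEquiv, Equiv.coe_fn_mk]
  rw [q.2, mul_comm]

/-- Exponent lists `(k₁,…,k_r,a)` of weight `w` with `kᵢ ≥ 1` and `a ≥ 2`. -/
noncomputable def exponentEquiv (r w : ℕ) :
    {q : (Fin r → ℕ) × ℕ // ∑ i, (q.1 i + 1) + (q.2 + 2) = w} ≃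
    {p : List ℕ × ℕ // p.1.length = r ∧ (∀ k ∈ p.1, 1 ≤ k) ∧ 2 ≤ p.2 ∧ p.1.sum + p.2 = w} :=
  Equiv.ofBijective
    (fun q => ⟨(List.ofFn (fun i => q.1.1 i + 1), q.1.2 + 2), by
      refine ⟨by simp, fun k hk => ?_, by simp, ?_⟩
      · obtain ⟨i, rfl⟩ := List.mem_ofFn.1 hk
        simp
      · rw [List.sum_ofFn]; exact q.2⟩)
    (by
      constructor
      · intro q q' h
        simp only [Subtype.mk.injEq, Prod.mk.injEq] at h
        have h1 := List.ofFn_injective h.1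
        refine Subtype.ext (Prod.ext (funext fun i => ?_) (by omega))
        simpa using congrFun h1 i
      · rintro ⟨⟨ks, a⟩, hl, hk, ha, hs⟩
        subst hl
        have hofFn : List.ofFn (fun i : Fin ks.length => ks.get i - 1 + 1) = ks := by
          conv_rhs => rw [← List.ofFn_get ks]
          congr 1
          funext i
          exact Nat.sub_add_cancel (hk _ (List.get_mem ks i))
        refine ⟨⟨(fun i => ks.get i - 1, a - 2), ?_⟩, ?_⟩
        · rw [← List.sum_ofFn, hofFn, Nat.sub_add_cancel ha]
          exact hs
        · simp only [Subtype.mk.injEq, Prod.mk.injEq]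
          exact ⟨hofFn, Nat.sub_add_cancel ha⟩)

theorem tsum_tsum_starCoeff (x y : ℝ≥0∞) :
    ∑' w : ℕ, (∑' r : ℕ, starCoeff r w * y ^ r) * x ^ w =
      ∑' m : ℕ, geomTail x 2 m * chainGen (geomTail x 1) y 0 m := by
  simp only [← ENNReal.tsum_mul_right, chainGen, ← ENNReal.tsum_mul_left]
  rw [ENNReal.tsum_comm]
  conv_rhs => rw [ENNReal.tsum_comm]
  refine tsum_congr fun r => ?_
  calc _ = y ^ r * ∑' w : ℕ, starCoeff r w * x ^ w := by
        rw [← ENNReal.tsum_mul_left]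
        exact tsum_congr fun w => by ring
    _ = _ := by
        rw [tsum_starCoeff, starGen_eq, ← ENNReal.tsum_mul_left]
        exact tsum_congr fun m => by ring

theorem geomTail_ofReal {x : ℝ} (hx : 0 < x) (hx1 : x < 1) (s m : ℕ) :
    geomTail (ENNReal.ofReal x) s m =
      ENNReal.ofReal ((x / (m + 1)) ^ s * ((m + 1) / (m + 1 - x))) := by
  have hm : (0:ℝ) ≤ m := m.cast_nonneg
  have ht : x / (m + 1) < 1 := by rw [div_lt_one (by positivity)]; linarith
  have hs := (hasSum_geometric_of_lt_one (by positivity) ht).mul_left ((x / (m + 1)) ^ s)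
  have e : (1 - x / ((m : ℝ) + 1))⁻¹ = (m + 1) / (m + 1 - x) := by
    have : (0:ℝ) < m + 1 - x := by linarith
    field_simp
  rw [← e, ← hs.tsum_eq, ENNReal.ofReal_tsum_of_nonneg (fun n => by positivity) hs.summable,
    geomTail]
  refine tsum_congr fun a => ?_
  rw [← pow_add, add_comm s a, ENNReal.ofReal_pow (by positivity),
    ENNReal.ofReal_div_of_pos (by positivity), div_eq_mul_inv]
  congr 3
  rw [ENNReal.ofReal_add hm zero_le_one]
  simp

theorem tsum_starCoeff_ofReal {x y : ℝ} (hx : 0 < x) (hx4 : x < 1 / 4) (hy : 0 < y) (hy1 : y < 1) :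
    ∑' w : ℕ, (∑' r : ℕ, starCoeff r w * ENNReal.ofReal y ^ r) * ENNReal.ofReal x ^ w =
      ENNReal.ofReal x * ∑' j : ℕ, ENNReal.ofReal
        (1 / (j + 1 - x * (1 + y)) - 1 / (j + 1 - x * (1 + y) + x)) := by
  have hxy : x * y < 1 / 4 := by nlinarith
  have hz : ∀ l : ℕ, ENNReal.ofReal y * geomTail (ENNReal.ofReal x) 1 l =
      ENNReal.ofReal (x * y / (l + 1 - x)) := fun l => by
    have hl : (0:ℝ) ≤ l := l.cast_nonneg
    have : (0:ℝ) < l + 1 - x := by linarith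
    rw [geomTail_ofReal hx (by linarith), ← ENNReal.ofReal_mul hy.le]
    congr 1
    field_simp
  have hz1 : ∀ l : ℕ, x * y / ((l : ℝ) + 1 - x) < 1 := fun l => by
    have hl : (0:ℝ) ≤ l := l.cast_nonneg
    rw [div_lt_one (by linarith)]
    linarith
  have hfac : ∀ l : ℕ, (1 - ENNReal.ofReal y * geomTail (ENNReal.ofReal x) 1 l)⁻¹ =
      ENNReal.ofReal ((l + 1 - x) / (l + 1 - x * (1 + y))) := fun l => by
    have hl : (0:ℝ) ≤ l := l.cast_nonneg
    have h1 : (0:ℝ) < l + 1 - x := by linarith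
    have h2 : (0:ℝ) < l + 1 - x * (1 + y) := by nlinarith
    rw [hz, ← ENNReal.ofReal_one, ← ENNReal.ofReal_sub _ (by positivity),
      ← ENNReal.ofReal_inv_of_pos (by linarith [hz1 l])]
    congr 1
    have : 1 - x * y / (l + 1 - x) = (l + 1 - x * (1 + y)) / (l + 1 - x) := by
      field_simp; ring
    rw [this, inv_div]
  rw [tsum_tsum_starCoeff, ← tsum_connector_div hx (by nlinarith) (by linarith),
    ← ENNReal.tsum_mul_left]
  refine tsum_congr fun m => ?_
  have hm : (0:ℝ) ≤ m := m.cast_nonneg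
  have hg := chainGen_eq_prod (geomTail (ENNReal.ofReal x) 1) (ENNReal.ofReal y)
    m 0
  simp only [zero_add, hfac] at hg
  have hm1 : (0:ℝ) < m + 1 - x := by linarith
  rw [hg, ← ENNReal.ofReal_prod_of_nonneg, geomTail_ofReal hx (by linarith),
    ← ENNReal.ofReal_mul (by positivity), ← ENNReal.ofReal_mul hx.le]
  · congr 1
    rw [Finset.prod_div_distrib, connector, prod_range_succ (fun l : ℕ => (l : ℝ) + 1 - x)]
    have hp : ∏ l ∈ range (m + 1), ((l : ℝ) + 1 - x * (1 + y)) ≠ 0 :=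
      prod_ne_zero_iff.2 fun l _ => by
        have hl : (0:ℝ) ≤ l := l.cast_nonneg
        exact (by nlinarith : (0:ℝ) < l + 1 - x * (1 + y)).ne'
    simp only [Nat.cast_zero, add_zero]
    field_simp
  · intro l _
    have hl : (0:ℝ) ≤ l := l.cast_nonneg
    exact div_nonneg (by linarith) (by nlinarith)

/-- The right-hand side of the sum formula, extended by zero to all `r` and `w`. -/
noncomputable def zetaCoeff (r w : ℕ) : ℝ≥0∞ :=
  if r + 2 ≤ w then ((w - 1).choose r : ℝ≥0∞) * ∑' j : ℕ, ((j + 1 : ℝ≥0∞) ^ w)⁻¹ else 0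

theorem tsum_zetaCoeff {y : ℝ} (hy : 0 < y) (u : ℕ) :
    ∑' r : ℕ, zetaCoeff r (u + 2) * ENNReal.ofReal y ^ r =
      ENNReal.ofReal ((1 + y) ^ (u + 1) - y ^ (u + 1)) *
        ∑' j : ℕ, ((j + 1 : ℝ≥0∞) ^ (u + 2))⁻¹ := by
  rw [tsum_eq_sum (s := range (u + 1)) (fun r hr => by
    rw [mem_range] at hr
    rw [zetaCoeff, if_neg (by omega), zero_mul])]
  have e : (1 + y) ^ (u + 1) - y ^ (u + 1) =
      ∑ r ∈ range (u + 1), ((u + 1).choose r : ℝ) * y ^ r := by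
    rw [add_comm 1 y, add_pow, sum_range_succ]
    simp [mul_comm]
  rw [e, ENNReal.ofReal_sum_of_nonneg (fun r _ => by positivity), sum_mul]
  refine sum_congr rfl fun r hr => ?_
  rw [mem_range] at hr
  rw [zetaCoeff, if_pos (by omega), ENNReal.ofReal_mul (by positivity), ENNReal.ofReal_natCast,
    ENNReal.ofReal_pow hy.le]
  simp only [Nat.add_succ_sub_one]
  ring

theorem tsum_zetaCoeff_ofReal {x y : ℝ} (hx : 0 < x) (hx4 : x < 1 / 4) (hy : 0 < y) (hy1 : y < 1) :
    ∑' w : ℕ, (∑' r : ℕ, zetaCoeff r w * ENNReal.ofReal y ^ r) * ENNReal.ofReal x ^ w =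
      ENNReal.ofReal x * ∑' j : ℕ, ENNReal.ofReal
        (1 / (j + 1 - x * (1 + y)) - 1 / (j + 1 - x * (1 + y) + x)) := by
  have hsplit : ∀ f : ℕ → ℝ≥0∞, ∑' w, f w = f 0 + (f 1 + ∑' u, f (u + 2)) := fun f => by
    rw [tsum_eq_zero_add' ENNReal.summable, tsum_eq_zero_add' ENNReal.summable]
  rw [hsplit]
  have hxy : x * y < 1 / 4 := by nlinarith
  have hz : ∀ r, zetaCoeff r 0 = 0 := fun r => if_neg (by omega)
  have hz' : ∀ r, zetaCoeff r 1 = 0 := fun r => if_neg (by omega)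
  simp only [hz, hz', zero_mul, tsum_zero, zero_add, tsum_zetaCoeff hy,
    ← ENNReal.tsum_mul_left, ← ENNReal.tsum_mul_right]
  rw [ENNReal.tsum_comm]
  refine tsum_congr fun j => ?_
  have hj : (0:ℝ) ≤ j := j.cast_nonneg
  set t := x / ((j : ℝ) + 1) with ht
  have ht0 : 0 < t := by positivity
  have htx : t ≤ x := div_le_self hx.le (by linarith)
  have h1 := (hasSum_geometric_of_lt_one (r := t * (1 + y)) (by positivity)
    (by nlinarith)).mul_left (t ^ 2 * (1 + y))
  have h2 := (hasSum_geometric_of_lt_one (r := t * y) (by positivity)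
    (by nlinarith)).mul_left (t ^ 2 * y)
  have h3 := h1.sub h2
  have hpow : ∀ u : ℕ, 0 ≤ (1 + y) ^ (u + 1) - y ^ (u + 1) := fun u =>
    sub_nonneg.2 (by gcongr; linarith)
  have e : ∀ u : ℕ, t ^ 2 * (1 + y) * (t * (1 + y)) ^ u - t ^ 2 * y * (t * y) ^ u =
      ((1 + y) ^ (u + 1) - y ^ (u + 1)) * t ^ (u + 2) := fun u => by
    rw [mul_pow, mul_pow]; ring
  simp only [e] at h3
  have e2 : x * (1 / (j + 1 - x * (1 + y)) - 1 / (j + 1 - x * (1 + y) + x)) =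
      t ^ 2 * (1 + y) * (1 - t * (1 + y))⁻¹ - t ^ 2 * y * (1 - t * y)⁻¹ := by
    have a1 : (0:ℝ) < j + 1 - x * (1 + y) := by nlinarith
    have a2 : (0:ℝ) < j + 1 - x * y := by nlinarith
    have b1 : 1 - t * (1 + y) = (j + 1 - x * (1 + y)) / (j + 1) := by rw [ht]; field_simp
    have b2 : 1 - t * y = (j + 1 - x * y) / (j + 1) := by rw [ht]; field_simp
    rw [b1, b2, show (j : ℝ) + 1 - x * (1 + y) + x = j + 1 - x * y by ring, ht]
    field_simp
    ring
  rw [← ENNReal.ofReal_mul hx.le, e2, ← h3.tsum_eq,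
    ENNReal.ofReal_tsum_of_nonneg (fun u => mul_nonneg (hpow u) (by positivity)) h3.summable]
  refine tsum_congr fun u => ?_
  rw [ENNReal.ofReal_mul (hpow u), ht, div_pow, ENNReal.ofReal_div_of_pos (by positivity),
    ENNReal.ofReal_pow hx.le, ENNReal.ofReal_pow (by positivity), ENNReal.ofReal_add hj zero_le_one,
    ENNReal.ofReal_natCast, ENNReal.ofReal_one, div_eq_mul_inv]
  ring

theorem starCoeff_eq_zetaCoeff (r w : ℕ) : starCoeff r w = zetaCoeff r w := by
  have hfin : ∀ x y : ℝ, 0 < x → x < 1 / 4 → 0 < y → y < 1 →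
      ∑' w : ℕ, (∑' r : ℕ, zetaCoeff r w * ENNReal.ofReal y ^ r) * ENNReal.ofReal x ^ w ≠ ∞ := by
    intro x y hx hx4 hy hy1
    rw [tsum_zetaCoeff_ofReal hx hx4 hy hy1]
    exact ENNReal.mul_ne_top ENNReal.ofReal_ne_top (tsum_ofReal_sub_ne_top hx (by nlinarith))
  refine coeff_eq_of_tsum_eq one_pos r (α := fun r => starCoeff r w)
    (β := fun r => zetaCoeff r w) (fun y hy hy1 => ?_) (fun y hy hy1 hc => ?_)
  · exact coeff_eq_of_tsum_eq (δ := 1 / 4) (by norm_num) w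
      (α := fun w => ∑' r : ℕ, starCoeff r w * ENNReal.ofReal y ^ r)
      (β := fun w => ∑' r : ℕ, zetaCoeff r w * ENNReal.ofReal y ^ r)
      (fun x hx hx4 => (tsum_starCoeff_ofReal hx hx4 hy hy1).trans
        (tsum_zetaCoeff_ofReal hx hx4 hy hy1).symm)
      (fun x hx hx4 => hfin x y hx hx4 hy hy1)
  · have h := ENNReal.ne_top_of_tsum_ne_top (hfin (1 / 8) y (by norm_num) (by norm_num) hy hy1) w
    rw [hc, ENNReal.top_mul (by simp)] at h
    exact h rfl

theorem starCoeff_ne_top (r w : ℕ) : starCoeff r w ≠ ∞ := by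
  rw [starCoeff_eq_zetaCoeff, zetaCoeff]
  split_ifs with h
  · refine ENNReal.mul_ne_top (ENNReal.natCast_ne_top _) ?_
    have hs : Summable fun j : ℕ => 1 / ((j : ℝ) + 1) ^ w := by
      have := (summable_nat_add_iff 1).2 (Real.summable_one_div_nat_pow.2 (show 1 < w by omega))
      push_cast at this
      exact this
    refine ne_top_of_le_ne_top hs.tsum_ofReal_ne_top (ENNReal.tsum_le_tsum fun j => le_of_eq ?_)
    have hj : (0:ℝ) ≤ j := j.cast_nonneg
    rw [one_div, ENNReal.ofReal_inv_of_pos (by positivity), ENNReal.ofReal_pow (by positivity),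
      ENNReal.ofReal_add hj zero_le_one, ENNReal.ofReal_natCast, ENNReal.ofReal_one]
  · exact ENNReal.zero_ne_top

/-- Sum formula for multiple zeta-star values: for `r ≥ 0` and `w ≥ r + 2`, the sum of
`ζ*(k₁,…,k_r,a)` over all `(k₁,…,k_r,a)` with `k₁+⋯+k_r+a = w`, `kᵢ ≥ 1`, `a ≥ 2`,
equals `C(w-1, r)·ζ(w)`. -/
theorem sum_formula_mzvStar (r w : ℕ) (hw : r + 2 ≤ w) :
    ∑' p : {p : List ℕ × ℕ //
        p.1.length = r ∧ (∀ k ∈ p.1, 1 ≤ k) ∧ 2 ≤ p.2 ∧ p.1.sum + p.2 = w},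
      mzvStar (p.1.1 ++ [p.1.2]) = ((w - 1).choose r : ℝ) * mzv [w] := by
  have hterm := ENNReal.ne_top_of_tsum_ne_top (starCoeff_ne_top r w)
  rw [← (exponentEquiv r w).tsum_eq, mzv_singleton]
  simp only [mzvStar_eq_toReal]
  refine (ENNReal.tsum_toReal_eq hterm).symm.trans ?_
  rw [← starCoeff, starCoeff_eq_zetaCoeff, zetaCoeff, if_pos hw, ENNReal.toReal_mul,
    ENNReal.toReal_natCast]
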